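/- Let I be a facet of an irreducible subword complex SC(Q,π) and let (F_1,F_2,…,F_ℓ) ≤ (F'_1,F'_2,…,F'_m) be flat-decompositions in FD. If F'_i ∪ F'_j ⊆ F_k for some i ≠ j and some k, then F'_i and F'_j are orthogonal in R(I), i.e., every root of F'_i is orthogonal to every root of F'_j. -/

import Mathlib

noncomputable section
open Classical

/-- A Coxeter group together with the data of its geometric representation:
the group `W` with distinguished generators indexed by `B`, acting on a real
vector space `V`, with simple roots `alpha`, a set of positive roots `pos`,
an invariant bilinear form `form`, and an assignment `refl` of reflections
to roots.  The axioms of such a system are collected in `GCS.IsGood`. -/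
structure GCS : Type 1 where
  B : Type
  W : Type
  [grp : Group W]
  V : Type
  [acg : AddCommGroup V]
  [mod : Module ℝ V]
  s : B → W
  act : W → V → V
  alpha : B → V
  pos : Set V
  form : V → V → ℝ
  refl : V → W

attribute [instance] GCS.grp GCS.acg GCS.mod

namespace GCS

/-- The root system `Φ`: the orbit of the simple roots. -/
def Phi (c : GCS) : Set c.V := {v | ∃ w b, c.act w (c.alpha b) = v}

/-- The axioms of a geometric representation of a Coxeter system. -/
structure IsGood (c : GCS) : Prop where
  s_sq : ∀ b, c.s b * c.s b = 1
  act_one : ∀ v, c.act 1 v = v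
  act_mul : ∀ g h v, c.act (g * h) v = c.act g (c.act h v)
  act_add : ∀ g u v, c.act g (u + v) = c.act g u + c.act g v
  act_smul : ∀ g (a : ℝ) v, c.act g (a • v) = a • c.act g v
  act_s : ∀ b v, c.act (c.s b) v = v - (2 * c.form (c.alpha b) v) • c.alpha b
  form_symm : ∀ u v, c.form u v = c.form v u
  form_linear : ∀ (a : ℝ) u u' v, c.form (a • u + u') v = a * c.form u v + c.form u' v
  form_inv : ∀ w u v, c.form (c.act w u) (c.act w v) = c.form u v
  form_alpha : ∀ b, c.form (c.alpha b) (c.alpha b) = 1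
  alpha_pos : ∀ b, c.alpha b ∈ c.pos
  alpha_indep : LinearIndependent ℝ c.alpha
  root_pos_xor : ∀ v ∈ c.Phi, Xor' (v ∈ c.pos) (-v ∈ c.pos)
  refl_eq : ∀ w b, c.refl (c.act w (c.alpha b)) = w * c.s b * w⁻¹
  act_faithful : ∀ g, (∀ v, c.act g v = v) → g = 1
  generates : Subgroup.closure (Set.range c.s) = ⊤

/-- Product of the images of the letters of a word, in order. -/
def gprod (c : GCS) {T : Type*} (gens : T → c.W) (l : List T) : c.W := (l.map gens).prod

/-- A word is reduced (w.r.t. a generating family) if no shorter word in the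
same generators has the same product. -/
def Reduced (c : GCS) {T : Type*} (gens : T → c.W) (l : List T) : Prop :=
  ∀ l' : List T, gprod c gens l' = gprod c gens l → l.length ≤ l'.length

/-- The list of the positions of `X`, in increasing order. -/
def posList {r : ℕ} (X : Finset (Fin r)) : List (Fin r) :=
  (List.finRange r).filter (fun k => k ∈ X)

/-- The subword of `q` at the positions of `X`, in increasing order. -/
def swAt {r : ℕ} {T : Type*} (q : Fin r → T) (X : Finset (Fin r)) : List T :=
  (posList X).map q

/-- `I` is a face of the subword complex `SC(Q, π)`: the complement of `I`
contains a reduced expression of `π`. -/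
def IsFace (c : GCS) {T : Type*} (gens : T → c.W) {r : ℕ} (q : Fin r → T) (π : c.W)
    (I : Finset (Fin r)) : Prop :=
  ∃ J : Finset (Fin r), Disjoint J I ∧ Reduced c gens (swAt q J) ∧ gprod c gens (swAt q J) = π

/-- `I` is a facet (maximal face) of the subword complex `SC(Q, π)`. -/
def IsFacet (c : GCS) {T : Type*} (gens : T → c.W) {r : ℕ} (q : Fin r → T) (π : c.W)
    (I : Finset (Fin r)) : Prop :=
  IsFace c gens q π I ∧ ∀ I' : Finset (Fin r), IsFace c gens q π I' → I ⊆ I' → I' = I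

/-- Positions before `j` in the complement of `I` (the set `A_j`). -/
def before {r : ℕ} (I : Finset (Fin r)) (j : Fin r) : Finset (Fin r) :=
  Finset.univ.filter (fun k => k < j ∧ k ∉ I)

/-- The root function of a subword complex (generic version, for any
generating family `gens` with associated simple roots `αT`). -/
def grootFn (c : GCS) {T : Type*} (gens : T → c.W) (αT : T → c.V) {n : ℕ}
    (q : Fin n → T) (I : Finset (Fin n)) (j : Fin n) : c.V :=
  c.act (gprod c gens (swAt q (before I j))) (αT (q j))

/-- The root function `r(I, ·)` of a subword complex. -/
def rootFn (c : GCS) {r : ℕ} (q : Fin r → c.B) (I : Finset (Fin r)) (j : Fin r) : c.V :=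
  grootFn c c.s c.alpha q I j

/-- `J` is (the set of positions of) a flat of the list of roots `r(I,Q)`:
the positions whose root lies in some linear subspace `U`. -/
def IsFlat (c : GCS) {r : ℕ} (q : Fin r → c.B) (I J : Finset (Fin r)) : Prop :=
  ∃ U : Submodule ℝ c.V, ∀ j : Fin r, j ∈ J ↔ rootFn c q I j ∈ U

/-- The span `V_F` of the roots of the flat. -/
def VF (c : GCS) {r : ℕ} (q : Fin r → c.B) (I J : Finset (Fin r)) : Submodule ℝ c.V :=
  Submodule.span ℝ ((fun j => rootFn c q I j) '' ↑J)

/-- The root subsystem `Φ_F = Φ ∩ V_F`. -/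
def PhiF (c : GCS) {r : ℕ} (q : Fin r → c.B) (I J : Finset (Fin r)) : Set c.V :=
  c.Phi ∩ ↑(VF c q I J)

/-- The positive roots `Φ_F⁺ = Φ⁺ ∩ V_F` of the root subsystem. -/
def PosF (c : GCS) {r : ℕ} (q : Fin r → c.B) (I J : Finset (Fin r)) : Set c.V :=
  c.pos ∩ PhiF c q I J

/-- `β` is a simple root of the root subsystem with positive roots `P`:
it is a positive root of the subsystem, and it is indecomposable, i.e. not a
positive linear combination of two other positive roots of the subsystem. -/
def IsSimpleIn (c : GCS) (P : Set c.V) (β : c.V) : Prop :=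
  β ∈ P ∧ ∀ γ₁ ∈ P, ∀ γ₂ ∈ P, γ₁ ≠ β → γ₂ ≠ β →
    ∀ a b : ℝ, 0 < a → 0 < b → β ≠ a • γ₁ + b • γ₂

/-- The set `Δ_F` of simple roots of the root subsystem `Φ_F`. -/
def DeltaF (c : GCS) {r : ℕ} (q : Fin r → c.B) (I J : Finset (Fin r)) : Set c.V :=
  {β | IsSimpleIn c (PosF c q I J) β}

/-- The `k`-th element `j_k` of `J` in increasing order. -/
def flatIdx {r : ℕ} (J : Finset (Fin r)) (k : Fin J.card) : Fin r :=
  ((J.orderIsoOfFin rfl) k : {x // x ∈ J})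

/-- Positions before `j` outside of `I` and outside of the flat `J`
(the set `B_j`). -/
def beforeF {r : ℕ} (I J : Finset (Fin r)) (j : Fin r) : Finset (Fin r) :=
  Finset.univ.filter (fun k => k < j ∧ k ∉ I ∧ k ∉ J)

/-- The roots `β_k = Q_{B_{j_k}}(α_{q_{j_k}})`. -/
def betaF (c : GCS) {r : ℕ} (q : Fin r → c.B) (I J : Finset (Fin r)) (k : Fin J.card) : c.V :=
  c.act (gprod c c.s (swAt q (beforeF I J (flatIdx J k)))) (c.alpha (q (flatIdx J k)))

/-- The letters of the word `Q_F`: the `k`-th letter is the generator of `W_F`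
corresponding to the simple root `β_k`, i.e. the reflection `s_{β_k}`,
viewed inside the ambient group. -/
def qeltF (c : GCS) {r : ℕ} (q : Fin r → c.B) (I J : Finset (Fin r)) (k : Fin J.card) : c.W :=
  c.refl (betaF c q I J k)

/-- The subset `I_F ⊆ [r']` corresponding to `I`. -/
def IF {r : ℕ} (I J : Finset (Fin r)) : Finset (Fin J.card) :=
  Finset.univ.filter (fun k => flatIdx J k ∈ I)

/-- The element `π_F`: product of the letters of `Q_F` at the complement of `I_F`. -/
def piF (c : GCS) {r : ℕ} (q : Fin r → c.B) (I J : Finset (Fin r)) : c.W :=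
  gprod c (qeltF c q I J) (swAt (fun k => k) (IF I J)ᶜ)

end GCS
namespace GCS

/-- The Coxeter group `W_F` of the root subsystem `Φ_F`, realized as the
subgroup of `W` generated by the reflections orthogonal to the roots of `Φ_F`. -/
def WFsub (c : GCS) {r : ℕ} (q : Fin r → c.B) (I J : Finset (Fin r)) : Subgroup c.W :=
  Subgroup.closure {w | ∃ β ∈ PhiF c q I J, c.refl β = w}

/-- The index set of the generators of `W_F`: the simple roots `Δ_F`
(enlarged, for definiteness, by the letters `β_k` of the word `Q_F`, which
are simple roots of `Φ_F` by Lemma 2.8). -/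
def BF (c : GCS) {r : ℕ} (q : Fin r → c.B) (I J : Finset (Fin r)) : Type :=
  {β : c.V // β ∈ DeltaF c q I J ∨ ∃ k, β = betaF c q I J k}

end GCS

/-- A tuple `(W, Q, π, I)`: a geometric Coxeter system, a word `Q` in its
generators, a group element `π`, and a subset `I` of positions of `Q`. -/
structure BTuple : Type 1 where
  gcs : GCS
  r : ℕ
  q : Fin r → gcs.B
  pi : gcs.W
  I : Finset (Fin r)

namespace GCS

/-- The restricted tuple `(W_F, Q_F, π_F, I_F)` associated to a flat `F`
(positions `J`) of `r(I,Q)`. -/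
def restrictTuple (c : GCS) {r : ℕ} (q : Fin r → c.B) (I J : Finset (Fin r)) : BTuple where
  gcs :=
    { B := BF c q I J
      W := ↥(WFsub c q I J)
      V := ↥(VF c q I J)
      s := fun b => if h : c.refl b.1 ∈ WFsub c q I J then ⟨c.refl b.1, h⟩ else 1
      act := fun w v => if h : c.act ↑w ↑v ∈ VF c q I J then ⟨c.act ↑w ↑v, h⟩ else 0
      alpha := fun b => if h : b.1 ∈ VF c q I J then ⟨b.1, h⟩ else 0
      pos := {v | ↑v ∈ c.pos}
      form := fun u v => c.form ↑u ↑v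
      refl := fun v => if h : c.refl ↑v ∈ WFsub c q I J then ⟨c.refl ↑v, h⟩ else 1 }
  r := J.card
  q := fun k => ⟨betaF c q I J k, Or.inr ⟨k, rfl⟩⟩
  pi := (((List.finRange J.card).filter (fun k => k ∉ IF I J)).map
    (fun k => if h : qeltF c q I J k ∈ WFsub c q I J
      then (⟨qeltF c q I J k, h⟩ : ↥(WFsub c q I J)) else 1)).prod
  I := IF I J

end GCS

/-- The tuple consisting of the trivial Coxeter system, the empty word, the
identity element, and the empty facet. -/
def emptyTuple : BTuple where
  gcs :=
    { B := Empty
      W := PUnit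
      V := PUnit
      s := fun b => b.elim
      act := fun _ v => v
      alpha := fun b => b.elim
      pos := ∅
      form := fun _ _ => 0
      refl := fun _ => 1 }
  r := 0
  q := Fin.elim0
  pi := 1
  I := ∅

/-- The product of two geometric Coxeter systems: the augmented Coxeter group
`W × W'` generated by the disjoint union of the generating sets, acting on
`V × V'`. -/
def prodGCS (c d : GCS) : GCS where
  B := c.B ⊕ d.B
  W := c.W × d.W
  V := c.V × d.V
  s := Sum.elim (fun b => (c.s b, 1)) (fun b => (1, d.s b))
  act := fun w v => (c.act w.1 v.1, d.act w.2 v.2)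
  alpha := Sum.elim (fun b => (c.alpha b, 0)) (fun b => (0, d.alpha b))
  pos := {v | (v.1 ∈ c.pos ∧ v.2 = 0) ∨ (v.1 = 0 ∧ v.2 ∈ d.pos)}
  form := fun u v => c.form u.1 v.1 + d.form u.2 v.2
  refl := fun v => (if v.2 = 0 then c.refl v.1 else 1, if v.1 = 0 then d.refl v.2 else 1)

/-- The subword complex multiplication of tuples:
`(W, Q, π, I) · (W', Q', π', I') = (W × W', QQ', ππ', I I')` with `QQ'` the
concatenation of the words and `I I'` the shifted union of the facets. -/
def prodTuple (T T' : BTuple) : BTuple where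
  gcs := prodGCS T.gcs T'.gcs
  r := T.r + T'.r
  q := fun j =>
    if h : (j : ℕ) < T.r then Sum.inl (T.q ⟨j, h⟩)
    else Sum.inr (T'.q ⟨(j : ℕ) - T.r, by have := j.isLt; omega⟩)
  pi := (T.pi, T'.pi)
  I := Finset.univ.filter (fun j : Fin (T.r + T'.r) =>
    if h : (j : ℕ) < T.r then (⟨j, h⟩ : Fin T.r) ∈ T.I
    else (⟨(j : ℕ) - T.r, by have := j.isLt; omega⟩ : Fin T'.r) ∈ T'.I)

namespace GCS

/-- The tuple `(W_F, Q_F, π_F, I_F)` associated to a flat decomposition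
`F = (F_1, …, F_m)`: the product of the restricted tuples of the parts. -/
def assocTuple (c : GCS) {r : ℕ} (q : Fin r → c.B) (I : Finset (Fin r))
    {m : ℕ} (Fn : Fin m → Finset (Fin r)) : BTuple :=
  ((List.finRange m).map (fun i => restrictTuple c q I (Fn i))).foldr prodTuple emptyTuple

end GCS

/-- One step of commutation of two consecutive commuting letters of a word
(together with the corresponding relabelling of a set of positions). -/
def SwapStepT (c : GCS) {r : ℕ} (p p' : (Fin r → c.B) × Finset (Fin r)) : Prop :=
  ∃ t u : Fin r, (t : ℕ) + 1 = (u : ℕ) ∧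
    c.s (p.1 t) * c.s (p.1 u) = c.s (p.1 u) * c.s (p.1 t) ∧
    p'.1 = p.1 ∘ (Equiv.swap t u) ∧
    p'.2 = p.2.image (Equiv.swap t u)

/-- Equivalence of tuples: a group isomorphism `φ : W ≃* W'` mapping
generators to generators, with `φ(Q) = Q'` up to commutation of consecutive
commuting letters, `φ(π) = π'`, and `I'` the set of positions corresponding
to `I`. -/
def TupleEquiv (T T' : BTuple) : Prop :=
  ∃ (φB : T.gcs.B ≃ T'.gcs.B) (φ : T.gcs.W ≃* T'.gcs.W),
    (∀ b, φ (T.gcs.s b) = T'.gcs.s (φB b)) ∧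
    φ T.pi = T'.pi ∧
    ∃ h : T.r = T'.r,
      Relation.ReflTransGen (SwapStepT T'.gcs)
        (fun j => φB (T.q (Fin.cast h.symm j)), T.I.image (Fin.cast h))
        (T'.q, T'.I)

namespace GCS

/-- `(F_1, …, F_m)` is a flat decomposition of `R(I)`: each part is an
irreducible flat of `r(I,Q)` (its span `V_{F_i}` equals the span of the root
configuration `R(I_{F_i})`), and the spans form a direct sum decomposition
`V = V_{F_1} ⊕ ⋯ ⊕ V_{F_m}`. -/
def IsFlatDecomp (c : GCS) {r : ℕ} (q : Fin r → c.B) (I : Finset (Fin r))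
    {m : ℕ} (Fn : Fin m → Finset (Fin r)) : Prop :=
  (∀ i, IsFlat c q I (Fn i)) ∧
  (∀ i, VF c q I (Fn i) =
    Submodule.span ℝ
      ((fun k => grootFn c (qeltF c q I (Fn i)) (betaF c q I (Fn i)) (fun k => k)
        (IF I (Fn i)) k) '' ↑(IF I (Fn i)))) ∧
  iSupIndep (fun i => VF c q I (Fn i)) ∧
  (⨆ i, VF c q I (Fn i)) = Submodule.span ℝ ((fun j => rootFn c q I j) '' ↑I)

/-- A flat decomposition of `R(I)` of unspecified length. -/
def Decomp (r : ℕ) : Type := Σ m : ℕ, Fin m → Finset (Fin r)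

/-- Membership of a decomposition in the set `FD` of flat decompositions of
length between `1` and `n`. -/
def InFD (c : GCS) {r : ℕ} (q : Fin r → c.B) (I : Finset (Fin r)) (n : ℕ)
    (D : Decomp r) : Prop :=
  1 ≤ D.1 ∧ D.1 ≤ n ∧ IsFlatDecomp c q I D.2

/-- Equivalence of flat decompositions: equivalence of the associated tuples. -/
def DecompEquiv (c : GCS) {r : ℕ} (q : Fin r → c.B) (I : Finset (Fin r))
    (D D' : Decomp r) : Prop :=
  TupleEquiv (assocTuple c q I D.2) (assocTuple c q I D'.2)

/-- `D'` refines `D`: the parts of `D'` partition the parts of `D` into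
consecutive blocks (encoded by a monotone surjection). -/
def Refines {r : ℕ} (D D' : Decomp r) : Prop :=
  ∃ g : Fin D'.1 → Fin D.1, Monotone g ∧ Function.Surjective g ∧
    ∀ i, D.2 i = (Finset.univ.filter (fun j => g j = i)).biUnion D'.2

/-- The refinement (pre)order on flat decompositions: `D ≤ D'` iff
`D ≅ D'` and `D'` refines `D`. -/
def FDle (c : GCS) {r : ℕ} (q : Fin r → c.B) (I : Finset (Fin r))
    (D D' : Decomp r) : Prop :=
  DecompEquiv c q I D D' ∧ Refines D D'

end GCS

/-- Reflections attached to a word with marked positions, starting at the prefix `p`. -/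
def refsL {G : Type*} [Group G] : G → List (G × Bool) → List G
  | _, [] => []
  | p, (s, b) :: l => (p * s * p⁻¹) :: refsL (if b then p else p * s) l

/-- Number of non commuting ordered pairs in a list. -/
def ncL {G : Type*} [Group G] (L : List G) : ℕ :=
  (L.map (fun a => L.countP (fun b => decide (a * b ≠ b * a)))).sum

theorem ncL_perm {G : Type*} [Group G] {L L' : List G} (h : L.Perm L') : ncL L = ncL L' := by
  unfold ncL
  have : (fun a => L.countP (fun b => decide (a * b ≠ b * a)))
      = (fun a => L'.countP (fun b => decide (a * b ≠ b * a))) := by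
    funext a; exact h.countP_eq _
  rw [this]
  exact (h.map _).sum_eq

theorem ncL_map {G H : Type*} [Group G] [Group H] (f : G →* H) (hf : Function.Injective f)
    (L : List G) : ncL (L.map f) = ncL L := by
  unfold ncL
  rw [List.map_map]
  congr 1
  apply List.map_congr_left
  intro a _
  simp only [Function.comp, List.countP_map]
  apply List.countP_congr
  intro b _
  simp only [Function.comp, decide_eq_true_eq, ← map_mul, ne_eq, hf.eq_iff]

theorem ncL_append {G : Type*} [Group G] (L M : List G)
    (h : ∀ a ∈ L, ∀ b ∈ M, a * b = b * a) : ncL (L ++ M) = ncL L + ncL M := by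
  unfold ncL
  rw [List.map_append, List.sum_append]
  congr 2
  · apply List.map_congr_left
    intro a ha
    rw [List.countP_append]
    have : M.countP (fun b => decide (a * b ≠ b * a)) = 0 := by
      rw [List.countP_eq_zero]; intro b hb; simp [h a ha b hb]
    omega
  · apply List.map_congr_left
    intro a ha
    rw [List.countP_append]
    have : L.countP (fun b => decide (a * b ≠ b * a)) = 0 := by
      rw [List.countP_eq_zero]; intro b hb; simp [h b hb a ha]
    omega

theorem refsL_map {G H : Type*} [Group G] [Group H] (f : G →* H) (l : List (G × Bool)) :
    ∀ p : G, (refsL p l).map f = refsL (f p) (l.map (fun x => (f x.1, x.2))) := by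
  induction l with
  | nil => intro p; rfl
  | cons x l ih =>
    intro p
    obtain ⟨s, b⟩ := x
    simp only [refsL, List.map_cons, ih, map_mul, map_inv]
    cases b <;> simp

theorem refsL_prod_right {G H : Type*} [Group G] [Group H] (l : List (H × Bool)) :
    ∀ (p : G) (p' : H), refsL (p, p') (l.map (fun x => ((1, x.1), x.2)))
      = (refsL p' l).map (fun x => ((1 : G), x)) := by
  induction l with
  | nil => intro p p'; rfl
  | cons x l ih =>
    intro p p'
    obtain ⟨s, b⟩ := x
    cases b <;> simp [refsL, ih]

theorem refsL_prod {G H : Type*} [Group G] [Group H] (l : List (G × Bool))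
    (l' : List (H × Bool)) :
    ∀ (p : G) (p' : H), refsL (p, p') (l.map (fun x => ((x.1, 1), x.2)) ++
        l'.map (fun x => ((1, x.1), x.2)))
      = (refsL p l).map (fun x => (x, (1 : H))) ++ (refsL p' l').map (fun x => ((1 : G), x)) := by
  induction l with
  | nil => intro p p'; simpa [refsL] using refsL_prod_right l' p p'
  | cons x l ih =>
    intro p p'
    obtain ⟨s, b⟩ := x
    cases b <;> simp [refsL, ih]

theorem ncL_prod {G H : Type*} [Group G] [Group H] (l : List (G × Bool))
    (l' : List (H × Bool)) :
    ncL (refsL 1 (l.map (fun x => ((x.1, (1 : H)), x.2)) ++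
        l'.map (fun x => (((1 : G), x.1), x.2)))) = ncL (refsL 1 l) + ncL (refsL 1 l') := by
  have h := refsL_prod l l' 1 1
  rw [← Prod.one_eq_mk] at h
  rw [h, ncL_append]
  · congr 1
    · exact ncL_map (MonoidHom.inl G H) (fun a b h => by simpa using h) _
    · exact ncL_map (MonoidHom.inr G H) (fun a b h => by simpa using h) _
  · intro a ha b hb
    simp only [List.mem_map] at ha hb
    obtain ⟨a, _, rfl⟩ := ha
    obtain ⟨b, _, rfl⟩ := hb
    simp

theorem refsL_swap {G : Type*} [Group G] :
    ∀ {r : ℕ} (f : Fin r → G × Bool) (t u : Fin r), (t : ℕ) + 1 = u →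
      (f t).1 * (f u).1 = (f u).1 * (f t).1 → ∀ p : G,
      (refsL p (List.ofFn f)).Perm (refsL p (List.ofFn (f ∘ Equiv.swap t u))) := by
  intro r
  induction r with
  | zero => intro f t; exact t.elim0
  | succ r ih =>
    intro f t u htu hc p
    rcases Fin.eq_zero_or_eq_succ t with rfl | ⟨t', rfl⟩
    · cases r with
      | zero => exfalso; have := u.isLt; simp at htu
      | succ r =>
        have hu : u = 1 := by ext; simp at htu ⊢; omega
        subst hu
        have h1 : List.ofFn f = f 0 :: f 1 :: List.ofFn (fun i : Fin r => f i.succ.succ) := by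
          simp [List.ofFn_succ]
        have h2 : List.ofFn (f ∘ Equiv.swap 0 1)
            = f 1 :: f 0 :: List.ofFn (fun i : Fin r => f i.succ.succ) := by
          have : ∀ i : Fin r, Equiv.swap (0 : Fin (r+2)) 1 i.succ.succ = i.succ.succ := by
            intro i
            apply Equiv.swap_apply_of_ne_of_ne
            · exact Fin.succ_ne_zero _
            · intro h; have := congrArg Fin.val h; simp at this
          simp [List.ofFn_succ, this]
        rw [h1, h2]
        generalize f 0 = a at *
        generalize f 1 = b at *
        obtain ⟨a, x⟩ := a
        obtain ⟨b, y⟩ := b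
        simp only at hc
        have e1 : a * b * a⁻¹ = b := by rw [hc]; group
        have e2 : b * a * b⁻¹ = a := by rw [← hc]; group
        have e3 : p * a * b * (p * a)⁻¹ = p * b * p⁻¹ := by
          calc _ = p * (a * b * a⁻¹) * p⁻¹ := by group
            _ = _ := by rw [e1]
        have e4 : p * b * a * (p * b)⁻¹ = p * a * p⁻¹ := by
          calc _ = p * (b * a * b⁻¹) * p⁻¹ := by group
            _ = _ := by rw [e2]
        have e5 : p * a * b = p * b * a := by rw [mul_assoc, hc, mul_assoc]
        cases x <;> cases y <;> simp only [refsL, if_true, if_false, Bool.false_eq_true, e3, e4] <;>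
          first
          | exact List.Perm.swap _ _ _
          | (rw [e5]; exact List.Perm.swap _ _ _)
    · obtain ⟨u', rfl⟩ : ∃ u', u = Fin.succ u' := by
        rcases Fin.eq_zero_or_eq_succ u with rfl | h
        · simp at htu
        · exact h
      have h0 : Equiv.swap t'.succ u'.succ 0 = 0 :=
        Equiv.swap_apply_of_ne_of_ne (Fin.succ_ne_zero _).symm (Fin.succ_ne_zero _).symm
      have hs : ∀ i : Fin r, Equiv.swap t'.succ u'.succ i.succ = (Equiv.swap t' u' i).succ := by
        intro i
        simp only [Equiv.swap_apply_def, Fin.succ_inj]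
        split_ifs <;> rfl
      have h2 : List.ofFn (f ∘ Equiv.swap t'.succ u'.succ)
          = f 0 :: List.ofFn ((fun i => f i.succ) ∘ Equiv.swap t' u') := by
        rw [List.ofFn_succ]
        simp only [Function.comp, h0, hs]
        rfl
      rw [h2, List.ofFn_succ]
      generalize f 0 = a
      obtain ⟨a, x⟩ := a
      simp only [refsL]
      apply List.Perm.cons
      apply ih (fun i => f i.succ) t' u'
      · simpa using htu
      · exact hc

/-- The marked word of a tuple. -/
def mword (c : GCS) {r : ℕ} (p : (Fin r → c.B) × Finset (Fin r)) : List (c.W × Bool) :=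
  List.ofFn (fun k => (c.s (p.1 k), decide (k ∈ p.2)))

/-- Number of noncommuting pairs of root reflections. -/
def ncT (T : BTuple) : ℕ := ncL (refsL 1 (mword T.gcs (T.q, T.I)))

theorem ncL_swapStep (c : GCS) {r : ℕ} (p p' : (Fin r → c.B) × Finset (Fin r))
    (h : SwapStepT c p p') :
    ncL (refsL 1 (mword c p)) = ncL (refsL 1 (mword c p')) := by
  obtain ⟨t, u, htu, hc, h1, h2⟩ := h
  apply ncL_perm
  have := refsL_swap (fun k => (c.s (p.1 k), decide (k ∈ p.2))) t u htu hc 1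
  have e : mword c p' = List.ofFn ((fun k => (c.s (p.1 k), decide (k ∈ p.2))) ∘ Equiv.swap t u) := by
    unfold mword
    congr 1
    funext k
    simp only [Function.comp, h1, h2, Prod.mk.injEq, true_and, decide_eq_decide, Finset.mem_image]
    constructor
    · rintro ⟨a, ha, rfl⟩; simpa using ha
    · intro hk; exact ⟨_, hk, by simp⟩
  rw [e]
  exact this

theorem ncT_equiv (T T' : BTuple) (h : TupleEquiv T T') : ncT T = ncT T' := by
  obtain ⟨φB, φ, hs, _, hr, hst⟩ := h
  have key : ∀ x y : (Fin T'.r → T'.gcs.B) × Finset (Fin T'.r), Relation.ReflTransGen (SwapStepT T'.gcs) x y →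
      ncL (refsL 1 (mword T'.gcs x)) = ncL (refsL 1 (mword T'.gcs y)) := by
    intro x y hxy
    induction hxy with
    | refl => rfl
    | tail _ h2 ih => exact ih.trans (ncL_swapStep _ _ _ h2)
  unfold ncT
  rw [← key _ _ hst, ← ncL_map φ.toMonoidHom φ.injective, refsL_map, map_one]
  congr 2
  unfold mword
  rw [List.map_ofFn, List.ofFn_congr hr]
  congr 1
  funext k
  simp only [Function.comp]
  refine Prod.ext ?_ ?_
  · exact hs _
  · simp only [decide_eq_decide, Finset.mem_image]
    constructor
    · intro hk; exact ⟨_, hk, by simp⟩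
    · rintro ⟨a, ha, rfl⟩; simpa using ha

theorem ncT_map (T : BTuple) {G : Type*} [Group G] (f : T.gcs.W →* G)
    (hf : Function.Injective f) :
    ncT T = ncL (refsL 1 (List.ofFn (fun k => (f (T.gcs.s (T.q k)), decide (k ∈ T.I))))) := by
  unfold ncT
  rw [← ncL_map f hf, refsL_map, map_one]
  unfold mword
  rw [List.map_ofFn]
  rfl

theorem ncT_prod (T T' : BTuple) : ncT (prodTuple T T') = ncT T + ncT T' := by
  unfold ncT
  refine Eq.trans ?_ (ncL_prod (mword T.gcs (T.q, T.I)) (mword T'.gcs (T'.q, T'.I)))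
  congr 2
  unfold mword
  rw [List.map_ofFn, List.map_ofFn]
  refine List.ofFn_add.trans ?_
  congr 1
  · congr 1
    funext k
    simp [prodTuple, prodGCS, Function.comp]
    exact decide_eq_decide.2 (Finset.mem_filter.trans (by simp))
  · congr 1
    funext k
    simp [prodTuple, prodGCS, Function.comp]
    exact decide_eq_decide.2 (Finset.mem_filter.trans (by simp))

theorem ncT_empty : ncT emptyTuple = 0 := by
  simp [ncT, mword, emptyTuple, ncL, refsL]

theorem ncT_foldr (L : List BTuple) :
    ncT (L.foldr prodTuple emptyTuple) = (L.map ncT).sum := by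
  induction L with
  | nil => exact ncT_empty
  | cons T L ih => simp [ncT_prod, ih]

theorem refsL_mem {G : Type*} [Group G] (H : Subgroup G) (l : List (G × Bool)) :
    ∀ p ∈ H, (∀ x ∈ refsL p l, x ∈ H) → ∀ x ∈ l, x.1 ∈ H := by
  induction l with
  | nil => intro p _ _ x hx; simp at hx
  | cons x l ih =>
    intro p hp h y hy
    obtain ⟨s, b⟩ := x
    simp only [refsL, List.mem_cons, forall_eq_or_imp] at h
    have hs : s ∈ H := by
      have := H.mul_mem (H.mul_mem (H.inv_mem hp) h.1) hp
      have e : p⁻¹ * (p * s * p⁻¹) * p = s := by group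
      rwa [e] at this
    rcases List.mem_cons.1 hy with rfl | hy
    · exact hs
    · refine ih _ ?_ h.2 y hy
      cases b
      · simpa using H.mul_mem hp hs
      · simpa using hp

namespace GCS

/-- The reflection attached to a position. -/
def tpos (c : GCS) {r : ℕ} (q : Fin r → c.B) (I : Finset (Fin r)) (x : Fin r) : c.W :=
  c.refl (rootFn c q I x)

/-- Unindexed version of the letters of `Q_F`. -/
def lpos (c : GCS) {r : ℕ} (q : Fin r → c.B) (I J : Finset (Fin r)) (x : Fin r) : c.W :=
  c.refl (c.act (gprod c c.s (swAt q (beforeF I J x))) (c.alpha (q x)))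

theorem ofFn_flatIdx {r : ℕ} (J : Finset (Fin r)) : List.ofFn (flatIdx J) = posList J := by
  apply List.Perm.eq_of_pairwise (le := (· < ·))
  · intro a b _ _ h1 h2; exact absurd h1 (lt_asymm h2)
  · rw [List.pairwise_ofFn]
    intro i j hij
    exact (J.orderIsoOfFin rfl).strictMono hij
  · exact (List.pairwise_lt_finRange r).filter _
  · rw [List.perm_ext_iff_of_nodup]
    · intro x
      simp only [List.mem_ofFn, posList, List.mem_filter, List.mem_finRange, true_and,
        decide_eq_true_eq]
      constructor
      · rintro ⟨k, rfl⟩; exact ((J.orderIsoOfFin rfl) k).2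
      · intro hx
        exact ⟨(J.orderIsoOfFin rfl).symm ⟨x, hx⟩, by simp [flatIdx]⟩
    · rw [List.nodup_ofFn]
      intro a b hab
      exact (J.orderIsoOfFin rfl).injective (Subtype.ext hab)
    · exact (List.nodup_finRange r).filter _

theorem filter_lt_split {r : ℕ} (l1 l2 : List (Fin r)) (j : Fin r)
    (h : l1 ++ j :: l2 = List.finRange r) (f g : Fin r → Bool)
    (hfg : ∀ k, f k = true ↔ k < j ∧ g k = true) :
    (List.finRange r).filter f = l1.filter g := by
  have hs := List.pairwise_lt_finRange r
  rw [← h] at hs ⊢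
  rw [List.pairwise_append, List.pairwise_cons] at hs
  obtain ⟨_, ⟨h2, _⟩, h3⟩ := hs
  rw [List.filter_append]
  have : (j :: l2).filter f = [] := by
    rw [List.filter_eq_nil_iff]
    intro a ha
    rw [hfg, not_and]
    intro hlt
    rcases List.mem_cons.1 ha with rfl | ha
    · exact absurd hlt (lt_irrefl _)
    · exact absurd hlt (lt_asymm (h2 a ha))
  rw [this, List.append_nil]
  apply List.filter_congr
  intro x hx
  have := h3 x hx j (by simp)
  rw [Bool.eq_iff_iff, hfg]
  simp [this]

theorem refsL_flat (c : GCS) (hg : c.IsGood) {r : ℕ} (q : Fin r → c.B) (I J : Finset (Fin r))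
    (l2 : List (Fin r)) :
    ∀ l1 : List (Fin r), l1 ++ l2 = List.finRange r →
    refsL (((l1.filter (fun k => decide (k ∉ I))).map (fun k => c.s (q k))).prod *
        (((l1.filter (fun k => decide (k ∉ I ∧ k ∉ J))).map (fun k => c.s (q k))).prod)⁻¹)
      ((l2.filter (fun k => decide (k ∈ J))).map (fun k => (lpos c q I J k, decide (k ∈ I))))
      = (l2.filter (fun k => decide (k ∈ J))).map (tpos c q I) := by
  induction l2 with
  | nil => intro l1 _; rfl
  | cons j l2 ih =>
    intro l1 h
    have ih' := ih (l1 ++ [j]) (by simpa using h)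
    have e1 : gprod c c.s (swAt q (beforeF I J j))
        = ((l1.filter (fun k => decide (k ∉ I ∧ k ∉ J))).map (fun k => c.s (q k))).prod := by
      rw [← filter_lt_split l1 l2 j h (fun k => decide (k ∈ beforeF I J j))
        (fun k => decide (k ∉ I ∧ k ∉ J)) (by simp [beforeF])]
      simp only [gprod, swAt, posList, List.map_map, Function.comp_def]
    have e2 : gprod c c.s (swAt q (before I j))
        = ((l1.filter (fun k => decide (k ∉ I))).map (fun k => c.s (q k))).prod := by
      rw [← filter_lt_split l1 l2 j h (fun k => decide (k ∈ before I j))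
        (fun k => decide (k ∉ I)) (by simp [before])]
      simp only [gprod, swAt, posList, List.map_map, Function.comp_def]
    have f1 : lpos c q I J j = _ := hg.refl_eq _ _
    have f2 : tpos c q I j = _ := hg.refl_eq _ _
    rw [e1] at f1
    rw [e2] at f2
    generalize hA : ((l1.filter (fun k => decide (k ∉ I))).map (fun k => c.s (q k))).prod = A at *
    generalize hB : ((l1.filter (fun k => decide (k ∉ I ∧ k ∉ J))).map
      (fun k => c.s (q k))).prod = B at *
    simp only [List.filter_append, List.map_append, List.prod_append, hA, hB] at ih'
    by_cases hJ : j ∈ J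
    · rw [List.filter_cons_of_pos (by simpa using hJ), List.map_cons, List.map_cons, refsL]
      congr 1
      · rw [f1, f2]; group
      · rw [← ih']
        congr 1
        by_cases hI : j ∈ I
        · simp [hI]
        · simp [hI, hJ, f1, mul_assoc]
    · rw [List.filter_cons_of_neg (by simpa using hJ), ← ih']
      congr 1
      by_cases hI : j ∈ I
      · simp [hI]
      · simp [hI, hJ]

theorem act_refl (c : GCS) (hg : c.IsGood) {a : c.V} (ha : a ∈ c.Phi) (v : c.V) :
    c.act (c.refl a) v = v - (2 * c.form a v) • a := by
  obtain ⟨w, b, rfl⟩ := ha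
  have hw : ∀ v, c.act w (c.act w⁻¹ v) = v := by
    intro v; rw [← hg.act_mul, mul_inv_cancel, hg.act_one]
  rw [hg.refl_eq, hg.act_mul, hg.act_mul, hg.act_s, sub_eq_add_neg, ← neg_smul, hg.act_add,
    hg.act_smul, hw, ← hg.form_inv w, hw, neg_smul, ← sub_eq_add_neg]

theorem form_root (c : GCS) (hg : c.IsGood) {a : c.V} (ha : a ∈ c.Phi) : c.form a a = 1 := by
  obtain ⟨w, b, rfl⟩ := ha
  rw [hg.form_inv, hg.form_alpha]

theorem root_ne_zero (c : GCS) (hg : c.IsGood) {a : c.V} (ha : a ∈ c.Phi) : a ≠ 0 := by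
  rintro rfl
  have h1 := form_root c hg ha
  have h2 := hg.form_linear 1 0 0 0
  rw [smul_zero, add_zero, h1] at h2
  norm_num at h2

theorem rootFn_mem (c : GCS) {r : ℕ} (q : Fin r → c.B) (I : Finset (Fin r)) (x : Fin r) :
    rootFn c q I x ∈ c.Phi := ⟨_, _, rfl⟩

theorem rootFn_mem_VF (c : GCS) {r : ℕ} (q : Fin r → c.B) (I J : Finset (Fin r)) (x : Fin r)
    (hx : x ∈ J) : rootFn c q I x ∈ VF c q I J :=
  Submodule.subset_span ⟨x, hx, rfl⟩

theorem orth_of_comm (c : GCS) (hg : c.IsGood) {a b : c.V} (ha : a ∈ c.Phi) (hb : b ∈ c.Phi)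
    (U U' : Submodule ℝ c.V) (hU : Disjoint U U') (haU : a ∈ U) (hbU : b ∈ U')
    (h : c.refl a * c.refl b = c.refl b * c.refl a) : c.form a b = 0 := by
  have h1 : c.act (c.refl a * c.refl b) a = c.act (c.refl b * c.refl a) a := by rw [h]
  rw [hg.act_mul, hg.act_mul] at h1
  have hm : ∀ (g : c.W) (t : ℝ) (u v : c.V), c.act g (u - t • v) = c.act g u - t • c.act g v := by
    intro g t u v
    rw [sub_eq_add_neg, ← neg_smul, hg.act_add, hg.act_smul, neg_smul, ← sub_eq_add_neg]
  simp only [act_refl c hg ha, act_refl c hg hb a, hm, form_root c hg ha] at h1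
  simp only [hg.form_symm b a] at h1
  have hfa : c.form a (a - (2 * c.form a b) • b) = 1 - 2 * c.form a b * c.form a b := by
    have e : a - (2 * c.form a b) • b = (-(2 * c.form a b)) • b + a := by module
    rw [e, hg.form_symm, hg.form_linear, form_root c hg ha, hg.form_symm b a]
    ring
  rw [hfa] at h1
  generalize c.form a b = f at *
  have h2 : (4 * f) • b = (4 * f ^ 2) • a := by
    rw [← sub_eq_zero] at h1 ⊢
    rw [← neg_eq_zero, ← h1]
    module
  have h3 : (4 * f) • b = 0 := by
    apply (Submodule.disjoint_def.1 hU)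
    · rw [h2]; exact U.smul_mem _ haU
    · exact U'.smul_mem _ hbU
  rcases smul_eq_zero.1 h3 with h4 | h4
  · linarith
  · exact absurd h4 (root_ne_zero c hg hb)

theorem ncL_posList {G : Type*} [Group G] {r : ℕ} (t : Fin r → G) (J : Finset (Fin r)) :
    ncL ((posList J).map t)
      = ((J ×ˢ J).filter (fun p => t p.1 * t p.2 ≠ t p.2 * t p.1)).card := by
  have hn : (posList J).Nodup := (List.nodup_finRange r).filter _
  have hJ : (posList J).toFinset = J := by ext x; simp [posList]
  have hc : ∀ P : Fin r → Bool, (posList J).countP P = (J.filter (fun k => P k = true)).card := by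
    intro P
    rw [List.countP_eq_length_filter, ← List.toFinset_card_of_nodup (hn.filter _),
      List.toFinset_filter, hJ]
  unfold ncL
  rw [List.map_map]
  simp only [Function.comp_def, List.countP_map]
  simp only [hc]
  rw [← List.sum_toFinset _ hn, hJ, Finset.card_filter, Finset.sum_product]
  simp only [Finset.card_filter, decide_eq_true_eq]

theorem ncT_restrict (c : GCS) (hg : c.IsGood) {r : ℕ} (q : Fin r → c.B) (I J : Finset (Fin r)) :
    ncT (restrictTuple c q I J) = ((J ×ˢ J).filter (fun p =>
      tpos c q I p.1 * tpos c q I p.2 ≠ tpos c q I p.2 * tpos c q I p.1)).card := by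
  have key := refsL_flat c hg q I J (List.finRange r) [] rfl
  simp only [List.filter_nil, List.map_nil, List.prod_nil, inv_one, mul_one] at key
  have key' : refsL 1 ((posList J).map (fun k => (lpos c q I J k, decide (k ∈ I))))
    = (posList J).map (tpos c q I) := key
  have hmem : ∀ k ∈ J, lpos c q I J k ∈ WFsub c q I J := by
    intro k hk
    refine refsL_mem (WFsub c q I J)
      ((posList J).map (fun k => (lpos c q I J k, decide (k ∈ I)))) 1 (one_mem _) ?_
      (lpos c q I J k, decide (k ∈ I)) ?_
    · rw [key']
      intro x hx
      obtain ⟨y, hy, rfl⟩ := List.mem_map.1 hx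
      have hy : y ∈ J := by simpa [posList] using hy
      exact Subgroup.subset_closure ⟨_, ⟨rootFn_mem c q I y, rootFn_mem_VF c q I J y hy⟩, rfl⟩
    · exact List.mem_map.2 ⟨k, by simpa [posList] using hk, rfl⟩
  rw [← ncL_posList, ← key', ← ofFn_flatIdx, List.map_ofFn]
  refine (ncT_map (restrictTuple c q I J) (WFsub c q I J).subtype
    Subtype.val_injective).trans ?_
  congr 2
  refine congrArg List.ofFn ?_
  funext k
  have hk : c.refl (betaF c q I J k) ∈ WFsub c q I J :=
    hmem (flatIdx J k) ((J.orderIsoOfFin rfl) k).2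
  refine Prod.ext ?_ ?_
  · simp only [Function.comp, restrictTuple, hk, dif_pos]
    rfl
  · have hIF : ∀ k : Fin J.card, k ∈ IF I J ↔ flatIdx J k ∈ I := by
      intro k; simp [IF]
    exact decide_eq_decide.2 (hIF k)

theorem decomp_disj (c : GCS) (hg : c.IsGood) {r : ℕ} (q : Fin r → c.B) (I : Finset (Fin r))
    {m : ℕ} (Fn : Fin m → Finset (Fin r)) (h : IsFlatDecomp c q I Fn) {i j : Fin m} {x : Fin r}
    (hi : x ∈ Fn i) (hj : x ∈ Fn j) : i = j := by
  by_contra hij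
  have := h.2.2.1.pairwiseDisjoint hij
  exact root_ne_zero c hg (rootFn_mem c q I x)
    ((Submodule.disjoint_def.1 this) _ (rootFn_mem_VF c q I _ x hi) (rootFn_mem_VF c q I _ x hj))

/-- Noncommuting pairs of positions inside a common part. -/
def ncPairs (c : GCS) {r : ℕ} (q : Fin r → c.B) (I : Finset (Fin r))
    {m : ℕ} (Fn : Fin m → Finset (Fin r)) : Finset (Fin r × Fin r) :=
  Finset.univ.biUnion (fun i => (Fn i ×ˢ Fn i).filter (fun p =>
      tpos c q I p.1 * tpos c q I p.2 ≠ tpos c q I p.2 * tpos c q I p.1))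

theorem ncT_assoc (c : GCS) (hg : c.IsGood) {r : ℕ} (q : Fin r → c.B) (I : Finset (Fin r))
    {m : ℕ} (Fn : Fin m → Finset (Fin r)) (h : IsFlatDecomp c q I Fn) :
    ncT (assocTuple c q I Fn) = (ncPairs c q I Fn).card := by
  unfold assocTuple ncPairs
  rw [ncT_foldr, List.map_map, Finset.card_biUnion]
  · simp only [Function.comp_def, ncT_restrict c hg]
    rw [← List.sum_toFinset _ (List.nodup_finRange m), List.toFinset_finRange]
  · intro i _ j _ hij
    refine Finset.disjoint_left.2 ?_
    intro p hp hp'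
    simp only [Finset.mem_filter, Finset.mem_product] at hp hp'
    exact hij (decomp_disj c hg q I Fn h hp.1.1 hp'.1.1)

end GCS

open GCS in
/-- Lemma 4.2: let `I` be a facet of an irreducible subword complex
`SC(Q, π)` and let `(F_1, …, F_ℓ) ≤ (F'_1, …, F'_m)` be flat decompositions
in `FD`.  If `F'_i ∪ F'_j ⊆ F_k` (with `i ≠ j`), then `F'_i` and `F'_j` are
orthogonal in `R(I)`: every root of `F'_i` is orthogonal to every root of
`F'_j`. -/
theorem refinement_parts_orthogonal
    (c : GCS) (hgood : c.IsGood) [Fintype c.B]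
    {r : ℕ} (q : Fin r → c.B) (π : c.W)
    (I : Finset (Fin r)) (hI : IsFacet c c.s q π I)
    (hirr : Submodule.span ℝ ((fun j => rootFn c q I j) '' ↑I) = ⊤)
    (D D' : Decomp r)
    (hD : InFD c q I (Fintype.card c.B) D)
    (hD' : InFD c q I (Fintype.card c.B) D')
    (hle : FDle c q I D D')
    (i j : Fin D'.1) (hij : i ≠ j) (k : Fin D.1)
    (hsub : D'.2 i ∪ D'.2 j ⊆ D.2 k) :
    ∀ x ∈ D'.2 i, ∀ y ∈ D'.2 j,
      c.form (rootFn c q I x) (rootFn c q I y) = 0 := by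
  intro x hx y hy
  have hsubset : ncPairs c q I D'.2 ⊆ ncPairs c q I D.2 := by
    obtain ⟨g, _, _, hg⟩ := hle.2
    have hin : ∀ a, D'.2 a ⊆ D.2 (g a) := by
      intro a z hz
      rw [hg]
      exact Finset.mem_biUnion.2 ⟨a, by simp, hz⟩
    intro p hp
    simp only [ncPairs, Finset.mem_biUnion, Finset.mem_univ, true_and, Finset.mem_filter,
      Finset.mem_product] at hp ⊢
    obtain ⟨a, ⟨h1, h2⟩, h3⟩ := hp
    exact ⟨g a, ⟨hin a h1, hin a h2⟩, h3⟩
  have hcard : (ncPairs c q I D.2).card ≤ (ncPairs c q I D'.2).card := by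
    rw [← ncT_assoc c hgood q I D.2 hD.2.2, ← ncT_assoc c hgood q I D'.2 hD'.2.2]
    exact (ncT_equiv _ _ hle.1).le
  have heq := Finset.eq_of_subset_of_card_le hsubset hcard
  have hcomm : tpos c q I x * tpos c q I y = tpos c q I y * tpos c q I x := by
    by_contra hne
    have hm : (x, y) ∈ ncPairs c q I D'.2 := by
      rw [heq]
      simp only [ncPairs, Finset.mem_biUnion, Finset.mem_univ, true_and, Finset.mem_filter,
        Finset.mem_product]
      exact ⟨k, ⟨hsub (Finset.mem_union_left _ hx), hsub (Finset.mem_union_right _ hy)⟩, hne⟩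
    simp only [ncPairs, Finset.mem_biUnion, Finset.mem_univ, true_and, Finset.mem_filter,
      Finset.mem_product] at hm
    obtain ⟨a, ⟨h1, h2⟩, _⟩ := hm
    exact hij ((decomp_disj c hgood q I D'.2 hD'.2.2 hx h1).trans
      (decomp_disj c hgood q I D'.2 hD'.2.2 hy h2).symm)
  exact orth_of_comm c hgood (rootFn_mem c q I x) (rootFn_mem c q I y) _ _
    (hD'.2.2.2.2.1.pairwiseDisjoint hij) (rootFn_mem_VF c q I _ x hx)
    (rootFn_mem_VF c q I _ y hy) hcomm
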